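/- Fix β>1 and ε>0. There exists a real number a(β,ε)>0 such that the set of external fields h₀∈ℝ for which there exists λ∈ℝ with the η-marginal of the Morita approximant measure converging weakly to the symmetric i.i.d. field distribution (i.e. for every N₀∈ℕ and every η̄∈{-1,1}^{N₀}, the probability K̂_{λ;β,ε,h₀,N}(η_i=η̄_i for i=1,…,N₀) tends to 2^{-N₀} as N→∞) is exactly ℝ∖[-a(β,ε), a(β,ε)]. -/

import Mathlib

open Real Filter MeasureTheory
open scoped Classical BigOperators

noncomputable section

/-- Map a Boolean to a ±1 spin value. -/
def spin (b : Bool) : ℝ := if b then 1 else -1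

/-- Hamiltonian (with sign absorbed) of the Morita approximant measure. -/
def morH (N : ℕ) (β ε h₀ lam : ℝ) (σ η : Fin N → Bool) : ℝ :=
  β / (2 * N) * (∑ i, spin (σ i)) ^ 2
    + β * ∑ i, (ε * spin (η i) + h₀) * spin (σ i)
    + lam * ∑ i, spin (η i)

/-- Partition function of the Morita approximant measure. -/
def morZ (N : ℕ) (β ε h₀ lam : ℝ) : ℝ :=
  ∑ σ : Fin N → Bool, ∑ η : Fin N → Bool, Real.exp (morH N β ε h₀ lam σ η)

/-- The Morita approximant measure on pairs of configurations. -/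
def morK (N : ℕ) (β ε h₀ lam : ℝ) (σ η : Fin N → Bool) : ℝ :=
  Real.exp (morH N β ε h₀ lam σ η) / morZ N β ε h₀ lam

/-- Probability under the Morita approximant measure that the first `N₀`
random-field variables agree with `ηbar`. -/
def etaCylProb (N₀ N : ℕ) (β ε h₀ lam : ℝ) (ηbar : Fin N₀ → Bool) : ℝ :=
  ∑ σ : Fin N → Bool, ∑ η : Fin N → Bool,
    if ∀ (i : Fin N₀) (h : (i : ℕ) < N), η ⟨i, h⟩ = ηbar i
    then morK N β ε h₀ lam σ η else 0

/-- `(h₀, lam)` is neutral: the η-marginal of the Morita approximant measures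
converges weakly to the symmetric i.i.d. field distribution. -/
def IsNeutral (β ε h₀ lam : ℝ) : Prop :=
  ∀ (N₀ : ℕ) (ηbar : Fin N₀ → Bool),
    Tendsto (fun N => etaCylProb N₀ N β ε h₀ lam ηbar) atTop (nhds ((2 : ℝ)⁻¹ ^ N₀))


lemma laplace (w g : ℝ → ℝ) (hw : Continuous w) (hpos : ∀ z, 0 < w z) (hint : Integrable w)
    (h0 : Tendsto w (cocompact ℝ) (nhds 0)) (hg : Continuous g) (Cb : ℝ) (hb : ∀ z, |g z| ≤ Cb)
    (c : ℝ) (hc : ∀ z, (∀ y, w y ≤ w z) → g z = c) :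
    Tendsto (fun N : ℕ => (∫ z, w z ^ N * g z) / (∫ z, w z ^ N)) atTop (nhds c) := by
  have hev : ∀ x, ∀ᶠ y in cocompact ℝ, w y ≤ w x := fun x => by
    filter_upwards [h0.eventually (gt_mem_nhds (hpos x))] with y hy using hy.le
  obtain ⟨z0, hz0⟩ := hw.exists_forall_ge' 0 (hev 0)
  have hpowint : ∀ n : ℕ, Integrable (fun z => w z ^ (n+1)) := by
    intro n
    have : Integrable (fun z => w z ^ n * w z) := by
      refine hint.bdd_mul (c := w z0 ^ n) (hw.pow n).aestronglyMeasurable ?_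
      refine Eventually.of_forall fun z => ?_
      rw [Real.norm_eq_abs, abs_of_pos (pow_pos (hpos z) n)]
      exact pow_le_pow_left₀ (hpos z).le (hz0 z) n
    simpa [pow_succ] using this
  have hpowgint : ∀ n : ℕ, Integrable (fun z => w z ^ (n+1) * g z) := by
    intro n
    refine (hpowint n).mul_bdd (c := Cb) hg.aestronglyMeasurable ?_
    exact Eventually.of_forall fun z => hb z
  have hC0 : 0 ≤ Cb := (abs_nonneg _).trans (hb 0)
  rw [← tendsto_add_atTop_iff_nat 1]
  rw [Metric.tendsto_atTop]
  intro δ hδ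
  obtain ⟨M', hM'pos, hM'lt, hM'⟩ : ∃ M', 0 < M' ∧ M' < w z0 ∧ ∀ z, δ/2 ≤ |g z - c| → w z ≤ M' := by
    by_cases hF : ∃ x, δ/2 ≤ |g x - c|
    · obtain ⟨x, hx⟩ := hF
      have hcl : IsClosed {z | δ/2 ≤ |g z - c|} :=
        isClosed_le continuous_const (hg.sub continuous_const).abs
      obtain ⟨z1, hz1, hmax⟩ := hw.continuousOn.exists_isMaxOn' hcl (x₀ := x) hx
        ((hev x).filter_mono inf_le_left)
      refine ⟨w z1, hpos _, ?_, fun z hz => hmax hz⟩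
      refine lt_of_le_of_ne (hz0 z1) fun h => ?_
      have := hc z1 (fun y => h ▸ hz0 y)
      have hz1' : δ/2 ≤ |g z1 - c| := hz1
      rw [this] at hz1'
      simp at hz1'
      linarith
    · push Not at hF
      refine ⟨w z0 / 2, half_pos (hpos _), half_lt_self (hpos _), fun z hz => ?_⟩
      exact absurd (hF z) (not_lt.mpr hz)
  set M'' := (M' + w z0)/2 with hM''
  have h1 : M' < M'' := by rw [hM'']; linarith
  have h2 : M'' < w z0 := by rw [hM'']; linarith
  have h3 : 0 < M'' := hM'pos.trans h1
  obtain ⟨r, hr, hball⟩ := Metric.eventually_nhds_iff.mp (hw.continuousAt.eventually (lt_mem_nhds h2))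
  have hlow : ∀ n : ℕ, r * M'' ^ (n+1) ≤ ∫ z, w z ^ (n+1) := by
    intro n
    have e2 : ∫ z in Set.Ioc (z0 - r/2) (z0 + r/2), w z ^ (n+1) ≤ ∫ z, w z ^ (n+1) :=
      setIntegral_le_integral (hpowint n) (Eventually.of_forall fun z => (pow_pos (hpos z) _).le)
    have e3 : ∫ z in Set.Ioc (z0 - r/2) (z0 + r/2), M'' ^ (n+1) ≤ ∫ z in Set.Ioc (z0 - r/2) (z0+r/2), w z ^ (n+1) := by
      refine setIntegral_mono_on (by simp) (hpowint n).integrableOn measurableSet_Ioc ?_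
      intro x hx
      refine pow_le_pow_left₀ h3.le ?_ _
      exact (hball (by rw [Real.dist_eq, abs_lt]; constructor <;> linarith [hx.1, hx.2])).le
    have e4 : ∫ z in Set.Ioc (z0 - r/2) (z0 + r/2), M'' ^ (n+1) = r * M'' ^ (n+1) := by
      rw [setIntegral_const]
      simp [Measure.real, hr.le]
    linarith
  have hup : ∀ n : ℕ, |∫ z, w z ^ (n+1) * (g z - c)| ≤
      δ/2 * (∫ z, w z ^ (n+1)) + (Cb + |c|) * M' ^ n * ∫ z, w z := by
    intro n
    rw [← integral_const_mul, ← integral_const_mul, ← integral_add ((hpowint n).const_mul _) (hint.const_mul _)]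
    refine abs_integral_le_integral_abs.trans ?_
    have hi : Integrable (fun z => w z ^ (n+1) * (g z - c)) := by
      simp only [mul_sub]
      exact (hpowgint n).sub ((hpowint n).mul_const c)
    refine integral_mono hi.abs (((hpowint n).const_mul _).add (hint.const_mul _)) ?_
    intro z
    have hwp := pow_pos (hpos z) (n+1)
    simp only [abs_mul, abs_of_pos hwp]
    have hgc : |g z - c| ≤ Cb + |c| := (abs_sub _ _).trans (by linarith [hb z])
    have hgc0 := abs_nonneg (g z - c)
    have hc0 := abs_nonneg c
    by_cases hz : δ/2 ≤ |g z - c|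
    · have a1 := hM' z hz
      have a2 : w z ^ n ≤ M' ^ n := pow_le_pow_left₀ (hpos z).le a1 n
      have a3 : w z ^ (n+1) * |g z - c| ≤ (M' ^ n * w z) * (Cb + |c|) := by
        rw [pow_succ]
        have := hpos z
        gcongr
      have : 0 ≤ δ/2 * w z ^ (n+1) := by positivity
      linarith
    · push Not at hz
      have a1 : w z ^ (n+1) * |g z - c| ≤ δ/2 * w z ^ (n+1) := by
        rw [mul_comm]; gcongr
      have : 0 ≤ (Cb + |c|) * M' ^ n * w z := by
        have := hpos z; positivity
      linarith
  have hIpos : ∀ n : ℕ, 0 < ∫ z, w z ^ (n+1) := fun n => lt_of_lt_of_le (by positivity) (hlow n)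
  have hIw : 0 < ∫ z, w z := by simpa using hIpos 0
  have hgeo : Tendsto (fun n : ℕ => (Cb + |c|) * (∫ z, w z) / (r * M'') * (M'/M'')^n) atTop (nhds 0) := by
    have := tendsto_pow_atTop_nhds_zero_of_lt_one (r := M'/M'') (by positivity) ((div_lt_one h3).2 h1)
    simpa using this.const_mul ((Cb + |c|) * (∫ z, w z) / (r * M''))
  obtain ⟨n0, hn0⟩ := eventually_atTop.mp (hgeo.eventually (gt_mem_nhds (half_pos hδ)))
  refine ⟨n0, fun n hn => ?_⟩
  have hI := hIpos n
  rw [Real.dist_eq]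
  have hsplit : (∫ z, w z ^ (n+1) * g z) / (∫ z, w z ^ (n+1)) - c
      = (∫ z, w z ^ (n+1) * (g z - c)) / (∫ z, w z ^ (n+1)) := by
    have : ∫ z, w z ^ (n+1) * (g z - c) = (∫ z, w z ^ (n+1) * g z) - (∫ z, w z ^ (n+1)) * c := by
      rw [← integral_mul_const, ← integral_sub (hpowgint n) ((hpowint n).mul_const c)]
      simp [mul_sub]
    rw [this]; field_simp
  rw [hsplit, abs_div, abs_of_pos hI, div_lt_iff₀ hI]
  refine (hup n).trans_lt ?_
  have k1 := hn0 n hn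
  have k2 : (Cb + |c|) * M' ^ n * (∫ z, w z) =
    (Cb + |c|) * (∫ z, w z) / (r * M'') * (M'/M'')^n * (r * M'' ^ (n+1)) := by
    rw [div_pow, pow_succ]; field_simp
  rw [k2]
  have k3 : (Cb + |c|) * (∫ z, w z) / (r * M'') * (M'/M'')^n * (r * M'' ^ (n+1)) < δ/2 * ∫ z, w z ^ (n+1) := by
    refine lt_of_lt_of_le (mul_lt_mul_of_pos_right k1 (by positivity)) ?_
    exact mul_le_mul_of_nonneg_left (hlow n) (by positivity)
  linarith

lemma gauss_sq (c S z : ℝ) (hc : 0 < c) :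
    exp (-c * z ^ 2 + z * S) = exp (S ^ 2 / (4 * c)) * exp (-c * (z - S / (2 * c)) ^ 2) := by
  rw [← exp_add]; congr 1; field_simp; ring

lemma gauss_int (c S : ℝ) (hc : 0 < c) : Integrable (fun z : ℝ => exp (-c * z ^ 2 + z * S)) := by
  simp_rw [gauss_sq c S _ hc]
  exact ((integrable_exp_neg_mul_sq hc).comp_sub_right (S / (2 * c))).const_mul _

lemma gauss_val (c S : ℝ) (hc : 0 < c) :
    ∫ z : ℝ, exp (-c * z ^ 2 + z * S) = exp (S ^ 2 / (4 * c)) * √(π / c) := by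
  simp_rw [gauss_sq c S _ hc]
  rw [integral_const_mul, integral_sub_right_eq_self (fun z : ℝ => exp (-c * z ^ 2)), integral_gaussian]

lemma gauss_tendsto (c S : ℝ) (hc : 0 < c) :
    Tendsto (fun z : ℝ => exp (-c * z ^ 2 + z * S)) (cocompact ℝ) (nhds 0) := by
  simp_rw [gauss_sq c S _ hc]
  have h := tendsto_rpow_abs_mul_exp_neg_mul_sq_cocompact hc 0
  simp only [rpow_zero, one_mul] at h
  have h2 := h.comp (Homeomorph.subRight (S / (2 * c))).isClosedEmbedding.tendsto_cocompact
  simpa using h2.const_mul (exp (S ^ 2 / (4 * c)))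

/-- Sum over the spin of the one-site weight. -/
def wP (t b lam z : ℝ) (e : Bool) : ℝ := 2 * exp (lam * spin e) * cosh (z + t * spin e + b)

def wS (t b lam z : ℝ) : ℝ := wP t b lam z true + wP t b lam z false

def wt (β t b lam z : ℝ) : ℝ := exp (-z ^ 2 / (2 * β)) * wS t b lam z

def pE (t b lam z : ℝ) (e : Bool) : ℝ := wP t b lam z e / wS t b lam z

lemma wP_pos (t b lam z : ℝ) (e : Bool) : 0 < wP t b lam z e := by
  unfold wP; have := cosh_pos (z + t * spin e + b); positivity

lemma wS_pos (t b lam z : ℝ) : 0 < wS t b lam z := add_pos (wP_pos _ _ _ _ _) (wP_pos _ _ _ _ _)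

lemma sum_site (t b lam z : ℝ) (e : Bool) :
    ∑ s : Bool, exp ((z + t * spin e + b) * spin s + lam * spin e) = wP t b lam z e := by
  have h1 : spin true = 1 := by simp [spin]
  have h2 : spin false = -1 := by simp [spin]
  rw [Fintype.sum_bool, h1, h2, wP, cosh_eq, exp_add, exp_add, mul_one, mul_neg_one]
  ring

lemma sum_sum_prod {N : ℕ} (F : Fin N → Bool → Bool → ℝ) :
    ∑ σ : Fin N → Bool, ∑ η : Fin N → Bool, ∏ i, F i (σ i) (η i)
      = ∏ i, ∑ e : Bool, ∑ s : Bool, F i s e := by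
  have h1 : ∀ σ : Fin N → Bool, ∑ η : Fin N → Bool, ∏ i, F i (σ i) (η i)
      = ∏ i, ∑ e : Bool, F i (σ i) e := by
    intro σ
    rw [Finset.prod_univ_sum, Fintype.piFinset_univ]
  simp_rw [h1]
  have h2 := Finset.prod_univ_sum (fun _ : Fin N => (Finset.univ : Finset Bool))
    (fun i s => ∑ e : Bool, F i s e)
  rw [Fintype.piFinset_univ] at h2
  rw [← h2]
  exact Finset.prod_congr rfl fun i _ => Finset.sum_comm

lemma rep_gen (N : ℕ) (hN : 0 < N) (β ε h₀ lam : ℝ) (hβ : 0 < β) (f : Fin N → Bool → ℝ) :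
    (∑ σ : Fin N → Bool, ∑ η : Fin N → Bool, (∏ i, f i (η i)) * exp (morH N β ε h₀ lam σ η))
      * √(π / (N / (2 * β)))
    = ∫ z : ℝ, exp (-(N / (2 * β)) * z ^ 2) *
        ∏ i, ∑ e : Bool, f i e * wP (β * ε) (β * h₀) lam z e := by
  have hN' : (0:ℝ) < N := by exact_mod_cast hN
  have hc : 0 < N / (2 * β) := by positivity
  have key : ∀ σ η : Fin N → Bool,
      (∏ i, f i (η i)) * exp (morH N β ε h₀ lam σ η) * √(π / (N / (2 * β)))
      = ∫ z : ℝ, ((∏ i, f i (η i)) * exp (β * ∑ i, (ε * spin (η i) + h₀) * spin (σ i)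
          + lam * ∑ i, spin (η i))) * exp (-(N / (2 * β)) * z ^ 2 + z * ∑ i, spin (σ i)) := by
    intro σ η
    rw [integral_const_mul, gauss_val _ _ hc]
    have : morH N β ε h₀ lam σ η = (β * ∑ i, (ε * spin (η i) + h₀) * spin (σ i)
          + lam * ∑ i, spin (η i)) + (∑ i, spin (σ i)) ^ 2 / (4 * (N / (2 * β))) := by
      unfold morH; field_simp; ring
    rw [this, exp_add]; ring
  simp_rw [Finset.sum_mul, key]
  have hint : ∀ σ η : Fin N → Bool, Integrable (fun z : ℝ => ((∏ i, f i (η i)) *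
      exp (β * ∑ i, (ε * spin (η i) + h₀) * spin (σ i)
          + lam * ∑ i, spin (η i))) * exp (-(N / (2 * β)) * z ^ 2 + z * ∑ i, spin (σ i))) :=
    fun σ η => (gauss_int _ _ hc).const_mul _
  have : ∀ σ : Fin N → Bool, _ := fun σ =>
    (integral_finsetSum Finset.univ (fun η _ => hint σ η)).symm
  simp_rw [this]
  rw [← integral_finsetSum Finset.univ
    (fun σ _ => integrable_finsetSum Finset.univ (fun η _ => hint σ η))]
  congr 1
  funext z
  simp_rw [← sum_site, Finset.mul_sum]
  rw [← sum_sum_prod (fun i s e => f i e * exp ((z + β * ε * spin e + β * h₀) * spin s + lam * spin e))]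
  simp_rw [Finset.mul_sum]
  refine Finset.sum_congr rfl fun σ _ => Finset.sum_congr rfl fun η _ => ?_
  rw [Finset.prod_mul_distrib, ← exp_sum, mul_left_comm, mul_assoc, ← exp_add, ← exp_add]
  congr 2
  rw [Finset.sum_add_distrib]
  have : ∑ i, (z + β * ε * spin (η i) + β * h₀) * spin (σ i)
      = z * ∑ i, spin (σ i) + β * ∑ i, (ε * spin (η i) + h₀) * spin (σ i) := by
    rw [Finset.mul_sum, Finset.mul_sum, ← Finset.sum_add_distrib]
    exact Finset.sum_congr rfl fun i _ => by ring
  rw [this]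
  simp only [← Finset.mul_sum]
  ring

lemma exp_pow_wt (N : ℕ) (β z : ℝ) (hβ : 0 < β) :
    exp (-(N / (2 * β)) * z ^ 2) = exp (-z ^ 2 / (2 * β)) ^ N := by
  rw [← exp_nat_mul]; congr 1; field_simp

lemma rep (N₀ M : ℕ) (hN : 0 < N₀ + M) (β ε h₀ lam : ℝ) (hβ : 0 < β) (ηbar : Fin N₀ → Bool) :
    etaCylProb N₀ (N₀ + M) β ε h₀ lam ηbar =
      (∫ z, wt β (β * ε) (β * h₀) lam z ^ (N₀ + M) * ∏ i, pE (β * ε) (β * h₀) lam z (ηbar i)) /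
      ∫ z, wt β (β * ε) (β * h₀) lam z ^ (N₀ + M) := by
  set f : Fin (N₀ + M) → Bool → ℝ := Fin.append (fun i e => if e = ηbar i then 1 else 0) (fun _ _ => 1)
    with hf
  have hind : ∀ η : Fin (N₀ + M) → Bool,
      (∏ i, f i (η i)) = if ∀ (i : Fin N₀) (h : (i : ℕ) < N₀ + M), η ⟨i, h⟩ = ηbar i then 1 else 0 := by
    intro η
    rw [Fin.prod_univ_add]
    simp only [hf, Fin.append_left, Fin.append_right, Finset.prod_const_one, mul_one]
    rw [Finset.prod_ite_zero]
    simp only [Finset.prod_const_one, Finset.mem_univ, forall_true_left]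
    congr 1
    apply propext
    constructor
    · intro h i hi; exact h i
    · intro h i; exact h i (by omega)
  have hN' : (0:ℝ) < (N₀ + M : ℕ) := by exact_mod_cast hN
  have hs : √(π / ((N₀ + M : ℕ) / (2 * β))) ≠ 0 := by
    have : 0 < π / ((N₀ + M : ℕ) / (2 * β)) := by have := pi_pos; positivity
    exact (sqrt_pos.2 this).ne'
  have h1 := rep_gen (N₀ + M) hN β ε h₀ lam hβ f
  have h2 := rep_gen (N₀ + M) hN β ε h₀ lam hβ (fun _ _ => 1)
  have e1 : etaCylProb N₀ (N₀ + M) β ε h₀ lam ηbar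
      = (∑ σ : Fin (N₀+M) → Bool, ∑ η : Fin (N₀+M) → Bool, (∏ i, f i (η i)) *
        exp (morH (N₀+M) β ε h₀ lam σ η)) / morZ (N₀+M) β ε h₀ lam := by
    unfold etaCylProb morK
    simp_rw [Finset.sum_div, hind]
    refine Finset.sum_congr rfl fun σ _ => Finset.sum_congr rfl fun η _ => ?_
    split_ifs <;> simp
  have e2 : morZ (N₀+M) β ε h₀ lam = ∑ σ : Fin (N₀+M) → Bool, ∑ η : Fin (N₀+M) → Bool,
      (∏ i : Fin (N₀+M), (1:ℝ)) * exp (morH (N₀+M) β ε h₀ lam σ η) := by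
    simp [morZ]
  rw [e1, e2, ← mul_div_mul_right _ _ hs, h1, h2]
  congr 1
  · congr 1; funext z
    rw [exp_pow_wt _ _ _ hβ, Fin.prod_univ_add]
    simp only [hf, Fin.append_left, Fin.append_right]
    have hS : ∑ e : Bool, wP (β * ε) (β * h₀) lam z e = wS (β * ε) (β * h₀) lam z := by
      simp [wS]
    simp only [wt, pE, Finset.prod_div_distrib, Finset.prod_const, Finset.card_univ,
      Fintype.card_fin, mul_pow, ite_mul, one_mul, zero_mul, Finset.sum_ite_eq', Finset.mem_univ, if_true, hS]
    have := (wS_pos (β * ε) (β * h₀) lam z).ne'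
    rw [pow_add (wS _ _ _ _)]
    field_simp
  · congr 1; funext z
    rw [exp_pow_wt _ _ _ hβ]
    simp [wt, wS, mul_pow]

lemma tanh_hasDeriv (x : ℝ) : HasDerivAt tanh (1 / cosh x ^ 2) x := by
  have h : HasDerivAt (fun x => sinh x / cosh x) ((cosh x * cosh x - sinh x * sinh x) / cosh x ^ 2) x :=
    (hasDerivAt_sinh x).div (hasDerivAt_cosh x) (cosh_pos x).ne'
  have e : (fun x => sinh x / cosh x) = tanh := by funext x; rw [tanh_eq_sinh_div_cosh]
  rw [e] at h
  convert h using 2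
  nlinarith [cosh_sq x]

lemma tanh_cont : Continuous tanh :=
  continuous_iff_continuousAt.2 fun x => (tanh_hasDeriv x).continuousAt

lemma tanh_smono : StrictMono tanh := by
  refine strictMono_of_deriv_pos fun x => ?_
  rw [(tanh_hasDeriv x).deriv]
  have := cosh_pos x; positivity

lemma tanh_pos' {x : ℝ} (hx : 0 < x) : 0 < tanh x := by
  have := tanh_smono hx; simpa using this

def Ft (β u : ℝ) : ℝ := u - β * tanh u

lemma Ft_hasDeriv (β u : ℝ) : HasDerivAt (Ft β) (1 - β * (1 / cosh u ^ 2)) u :=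
  (hasDerivAt_id u).sub ((tanh_hasDeriv u).const_mul β)

lemma Ft_cont (β : ℝ) : Continuous (Ft β) := continuous_id.sub (continuous_const.mul tanh_cont)

lemma Ft_root (β : ℝ) (hβ : 1 < β) : ∃ us, 0 < us ∧ Ft β us = 0 ∧ (∀ u, 0 < u → u < us → Ft β u < 0) ∧
    StrictMonoOn (Ft β) (Set.Ici us) := by
  have hs1 : 1 < √β := by rw [lt_sqrt] <;> linarith
  set c := arcosh (√β) with hc
  have hcosh : cosh c = √β := cosh_arcosh hs1.le
  have hc0 : 0 < c := arcosh_pos hs1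
  have hcs : cosh c ^ 2 = β := by rw [hcosh, sq_sqrt (by linarith)]
  have hF0 : Ft β 0 = 0 := by simp [Ft]
  have anti : StrictAntiOn (Ft β) (Set.Icc 0 c) := by
    refine strictAntiOn_of_deriv_neg (convex_Icc 0 c) (Ft_cont β).continuousOn fun x hx => ?_
    rw [interior_Icc] at hx
    rw [(Ft_hasDeriv β x).deriv]
    have h1 : cosh x < cosh c := cosh_strictMonoOn hx.1.le hc0.le hx.2
    have h2 := cosh_pos x
    have h3 : cosh x ^ 2 < β := by rw [← hcs]; gcongr
    have : 1 < β / cosh x ^ 2 := by rw [lt_div_iff₀ (by positivity)]; linarith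
    rw [mul_one_div]; linarith
  have mono : StrictMonoOn (Ft β) (Set.Ici c) := by
    refine strictMonoOn_of_deriv_pos (convex_Ici c) (Ft_cont β).continuousOn fun x hx => ?_
    rw [interior_Ici] at hx
    have hx : c < x := hx
    rw [(Ft_hasDeriv β x).deriv]
    have h1 : cosh c < cosh x := cosh_strictMonoOn hc0.le (hc0.trans hx).le hx
    have h2 := cosh_pos c
    have h3 : β < cosh x ^ 2 := by rw [← hcs]; gcongr
    have : β / cosh x ^ 2 < 1 := by rw [div_lt_iff₀ (by linarith)]; linarith
    rw [mul_one_div]; linarith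
  have hFc : Ft β c < 0 := by
    rw [← hF0]; exact anti ⟨le_rfl, hc0.le⟩ ⟨hc0.le, le_rfl⟩ hc0
  have hFb : 0 < Ft β (c + β) := by
    unfold Ft; nlinarith [tanh_lt_one (c + β)]
  obtain ⟨us, hus, hus0⟩ := intermediate_value_Icc (by linarith : c ≤ c + β) (Ft_cont β).continuousOn
    ⟨hFc.le, hFb.le⟩
  have hcu : c < us := lt_of_le_of_ne hus.1 fun h => by rw [h] at hFc; linarith
  refine ⟨us, by linarith, hus0, fun u hu0 hu => ?_, mono.mono fun x hx => hcu.le.trans hx⟩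
  rcases le_total u c with h | h
  · rw [← hF0]; exact anti ⟨le_rfl, hc0.le⟩ ⟨hu0.le, h⟩ hu0
  · rw [← hus0]; exact mono h hcu.le hu

/-- effective field -/
def kf (t l : ℝ) : ℝ := (log (cosh (l + t)) - log (cosh (l - t))) / 2

lemma kf_cont (t : ℝ) : Continuous (kf t) := by
  unfold kf
  have h1 : Continuous fun l : ℝ => log (cosh (l + t)) :=
    Continuous.log (by fun_prop) fun l => (cosh_pos _).ne'
  have h2 : Continuous fun l : ℝ => log (cosh (l - t)) :=
    Continuous.log (by fun_prop) fun l => (cosh_pos _).ne'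
  exact (h1.sub h2).div_const 2

lemma kf_smono (t : ℝ) (ht : 0 < t) : StrictMono (kf t) := by
  refine strictMono_of_deriv_pos fun l => ?_
  have h1 : HasDerivAt (fun l : ℝ => log (cosh (l + t))) (sinh (l + t) / cosh (l + t)) l := by
    have := ((hasDerivAt_id l).add_const t).cosh.log (cosh_pos _).ne'
    simpa using this
  have h2 : HasDerivAt (fun l : ℝ => log (cosh (l - t))) (sinh (l - t) / cosh (l - t)) l := by
    have := ((hasDerivAt_id l).sub_const t).cosh.log (cosh_pos _).ne'
    simpa using this
  have h3 : HasDerivAt (kf t) _ l := (h1.sub h2).div_const 2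
  rw [h3.deriv, ← tanh_eq_sinh_div_cosh, ← tanh_eq_sinh_div_cosh]
  have := tanh_smono (by linarith : l - t < l + t)
  linarith

lemma kf_zero (t : ℝ) : kf t 0 = 0 := by simp [kf]

lemma kf_neg (t l : ℝ) : kf t (-l) = - kf t l := by
  unfold kf
  rw [show -l + t = -(l - t) by ring, show -l - t = -(l + t) by ring, cosh_neg, cosh_neg]; ring

lemma kf_exp (t l : ℝ) : exp (-kf t l) * cosh (l + t) = exp (kf t l) * cosh (l - t) := by
  have h : cosh (l + t) = exp (kf t l) * exp (kf t l) * cosh (l - t) := by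
    rw [← exp_add, kf, ← add_div, add_self_div_two, exp_sub, exp_log (cosh_pos _), exp_log (cosh_pos _)]
    have := (cosh_pos (l - t)).ne'
    field_simp
  rw [h, exp_neg]
  have := exp_pos (kf t l)
  field_simp

def lamf (t u : ℝ) : ℝ := arsinh (tanh u * sinh (2 * t)) / 2

def Gt (β t u : ℝ) : ℝ := Ft β u + kf t (lamf t u)

lemma lamf_smono (t : ℝ) (ht : 0 < t) : StrictMono (lamf t) := by
  intro u v huv
  have h : 0 < sinh (2 * t) := sinh_pos_iff.2 (by linarith)
  have := arsinh_strictMono (mul_lt_mul_of_pos_right (tanh_smono huv) h)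
  unfold lamf; linarith

lemma lamf_zero (t : ℝ) : lamf t 0 = 0 := by simp [lamf]

lemma Gt_cont (β t : ℝ) : Continuous (Gt β t) := by
  have h : Continuous (lamf t) := by
    unfold lamf
    exact ((tanh_cont.mul continuous_const).arsinh).div_const 2
  exact (Ft_cont β).add ((kf_cont t).comp h)

lemma kl_pos (t u : ℝ) (ht : 0 < t) (hu : 0 < u) : 0 < kf t (lamf t u) := by
  have h := lamf_smono t ht hu
  rw [lamf_zero] at h
  have := kf_smono t ht h
  rwa [kf_zero] at this

lemma wP_diff (t b lam u : ℝ) :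
    wP t b lam (u - (b + kf t lam)) true - wP t b lam (u - (b + kf t lam)) false
      = 2 * (exp u * (exp (-kf t lam) * sinh (lam + t)) + exp (-u) * (exp (kf t lam) * sinh (lam - t))) := by
  have h1 : spin true = 1 := by simp [spin]
  have h2 : spin false = -1 := by simp [spin]
  simp only [wP, h1, h2, cosh_eq, sinh_eq]
  ring_nf
  simp only [← exp_add]
  ring_nf

lemma wS_eq (t b lam u : ℝ) :
    wS t b lam (u - (b + kf t lam)) = 4 * (exp (-kf t lam) * cosh (lam + t)) * cosh u := by
  have h1 : spin true = 1 := by simp [spin]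
  have h2 : spin false = -1 := by simp [spin]
  have h : wS t b lam (u - (b + kf t lam)) =
     2 * (exp u * (exp (-kf t lam) * cosh (lam + t)) + exp (-u) * (exp (kf t lam) * cosh (lam - t))) := by
    simp only [wS, wP, h1, h2, cosh_eq]
    ring_nf
    simp only [← exp_add]
    ring_nf
  rw [h, ← kf_exp, cosh_eq u]; ring

/-- conditional mean of η given the tilted field -/
def qf (t lam u : ℝ) : ℝ :=
  (tanh (lam + t) + tanh (lam - t)) / 2 + (tanh (lam + t) - tanh (lam - t)) / 2 * tanh u

lemma pE_eq (t b lam u : ℝ) (e : Bool) :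
    pE t b lam (u - (b + kf t lam)) e = (1 + spin e * qf t lam u) / 2 := by
  have hS := wS_eq t b lam u
  have hD := wP_diff t b lam u
  have hq : wP t b lam (u - (b + kf t lam)) true - wP t b lam (u - (b + kf t lam)) false
      = wS t b lam (u - (b + kf t lam)) * qf t lam u := by
    rw [hD, hS]
    have e1 : exp (-kf t lam) * sinh (lam + t) = exp (-kf t lam) * cosh (lam + t) * tanh (lam + t) := by
      rw [tanh_eq_sinh_div_cosh]; have := (cosh_pos (lam + t)).ne'; field_simp
    have e2 : exp (kf t lam) * sinh (lam - t) = exp (-kf t lam) * cosh (lam + t) * tanh (lam - t) := by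
      rw [kf_exp, tanh_eq_sinh_div_cosh]; have := (cosh_pos (lam - t)).ne'; field_simp
    have e3 : cosh u * qf t lam u = cosh u * ((tanh (lam + t) + tanh (lam - t)) / 2)
       + (tanh (lam + t) - tanh (lam - t)) / 2 * sinh u := by
      rw [qf, tanh_eq_sinh_div_cosh u]; have := (cosh_pos u).ne'; field_simp
    rw [e1, e2, mul_assoc _ (cosh u), e3, cosh_eq u, sinh_eq u]; ring
  have hpos := wS_pos t b lam (u - (b + kf t lam))
  have hs : wP t b lam (u - (b + kf t lam)) true + wP t b lam (u - (b + kf t lam)) false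
      = wS t b lam (u - (b + kf t lam)) := rfl
  unfold pE
  rw [div_eq_iff hpos.ne']
  cases e
  · have h2 : spin false = -1 := by simp [spin]
    rw [h2]; linarith
  · have h1 : spin true = 1 := by simp [spin]
    rw [h1]; linarith

lemma qf_zero_iff (t lam u : ℝ) (ht : 0 < t) : qf t lam u = 0 ↔ lam = - lamf t u := by
  have hB : qf t lam u * (2 * (cosh (lam + t) * cosh (lam - t))) = sinh (2 * lam) + tanh u * sinh (2 * t) := by
    have a1 : sinh (2 * lam) = sinh (lam + t) * cosh (lam - t) + cosh (lam + t) * sinh (lam - t) := by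
      rw [← sinh_add]; congr 1; ring
    have a2 : sinh (2 * t) = sinh (lam + t) * cosh (lam - t) - cosh (lam + t) * sinh (lam - t) := by
      rw [← sinh_sub]; congr 1; ring
    rw [a1, a2, qf, tanh_eq_sinh_div_cosh (lam + t), tanh_eq_sinh_div_cosh (lam - t)]
    have := (cosh_pos (lam + t)).ne'
    have := (cosh_pos (lam - t)).ne'
    field_simp
  have hp : 0 < 2 * (cosh (lam + t) * cosh (lam - t)) := by
    have := cosh_pos (lam + t)
    have := cosh_pos (lam - t)
    positivity
  constructor
  · intro h
    rw [h, zero_mul] at hB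
    have h2 : sinh (-(2 * lam)) = tanh u * sinh (2 * t) := by rw [sinh_neg]; linarith
    unfold lamf
    rw [← h2, arsinh_sinh]; ring
  · intro h
    have h2 : sinh (-(2 * lam)) = tanh u * sinh (2 * t) := by
      rw [h, lamf, show -(2 * -(arsinh (tanh u * sinh (2 * t)) / 2)) = arsinh (tanh u * sinh (2 * t)) by ring,
        sinh_arsinh]
    rw [sinh_neg] at h2
    have : qf t lam u * (2 * (cosh (lam + t) * cosh (lam - t))) = 0 := by rw [hB]; linarith
    rcases mul_eq_zero.1 this with h | h
    · exact h
    · exact absurd h (ne_of_gt hp)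

/-- reduced weight -/
def vf (β H z : ℝ) : ℝ := exp (-z ^ 2 / (2 * β)) * cosh (z + H)

lemma vf_hasDeriv (β H z : ℝ) (hβ : 0 < β) :
    HasDerivAt (vf β H) (exp (-z ^ 2 / (2 * β)) * (cosh (z + H) * (tanh (z + H) - z / β))) z := by
  have h1 : HasDerivAt (fun z : ℝ => -z ^ 2 / (2 * β)) (-(2 * z) / (2 * β)) z := by
    have := ((hasDerivAt_pow 2 z).neg).div_const (2 * β)
    simpa using this
  have h2 : HasDerivAt (fun z : ℝ => cosh (z + H)) (sinh (z + H)) z := by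
    simpa using ((hasDerivAt_id z).add_const H).cosh
  refine (h1.exp.mul h2).congr_deriv ?_
  rw [tanh_eq_sinh_div_cosh]
  have := (cosh_pos (z + H)).ne'
  field_simp
  ring

lemma vf_cont (β H : ℝ) : Continuous (vf β H) := by unfold vf; fun_prop

lemma vf_crit (β H z : ℝ) (hβ : 0 < β) (hz : ∀ y, vf β H y ≤ vf β H z) : z = β * tanh (z + H) := by
  have h : IsLocalMax (vf β H) z := Eventually.of_forall hz
  have := h.hasDerivAt_eq_zero (vf_hasDeriv β H z hβ)
  have h1 := exp_pos (-z ^ 2 / (2 * β))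
  have h2 := cosh_pos (z + H)
  have h3 : tanh (z + H) - z / β = 0 := by
    rcases mul_eq_zero.1 this with h | h
    · exact absurd h h1.ne'
    · rcases mul_eq_zero.1 h with h | h
      · exact absurd h h2.ne'
      · exact h
  field_simp at h3
  linarith

lemma vf_max_pos (β H z : ℝ) (hβ : 0 < β) (hH : 0 < H) (hz : ∀ y, vf β H y ≤ vf β H z) :
    0 < z + H ∧ Ft β (z + H) = H := by
  have hc := vf_crit β H z hβ hz
  refine ⟨?_, by unfold Ft; linarith⟩
  by_contra hneg
  push Not at hneg
  have hz0 : z < 0 := by linarith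
  have h := hz (-z)
  unfold vf at h
  rw [neg_sq] at h
  have h2 := le_of_mul_le_mul_left h (exp_pos _)
  rw [cosh_le_cosh, abs_of_pos (by linarith), abs_of_nonpos hneg] at h2
  linarith

lemma vf_max_zero (β us z : ℝ) (hβ : 1 < β) (h0 : 0 < us) (hus : Ft β us = 0)
    (hneg : ∀ u, 0 < u → u < us → Ft β u < 0) (hmono : StrictMonoOn (Ft β) (Set.Ici us))
    (hz : ∀ y, vf β 0 y ≤ vf β 0 z) : tanh z ^ 2 = tanh us ^ 2 := by
  have hβ0 : 0 < β := by linarith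
  have hc := vf_crit β 0 z hβ0 hz
  rw [add_zero] at hc
  have hF : Ft β z = 0 := by unfold Ft; linarith
  have hroot : ∀ x, 0 < x → Ft β x = 0 → x = us := by
    intro x hx hFx
    rcases lt_trichotomy x us with h | h | h
    · linarith [hneg x hx h]
    · exact h
    · have := hmono Set.self_mem_Ici h.le h; linarith
  rcases lt_trichotomy z 0 with h | h | h
  · have : -z = us := hroot (-z) (by linarith) (by unfold Ft at *; rw [tanh_neg]; linarith)
    rw [← this, tanh_neg]; ring
  · exfalso
    have hm : StrictMonoOn (vf β 0) (Set.Icc 0 us) := by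
      refine strictMonoOn_of_deriv_pos (convex_Icc _ _) (vf_cont β 0).continuousOn fun x hx => ?_
      rw [interior_Icc] at hx
      rw [(vf_hasDeriv β 0 x hβ0).deriv, add_zero]
      have a1 := hneg x hx.1 hx.2
      have a2 : 0 < tanh x - x / β := by
        unfold Ft at a1
        rw [sub_pos, div_lt_iff₀ hβ0]; linarith
      have := cosh_pos x
      positivity
    have := hm ⟨le_rfl, h0.le⟩ ⟨h0.le, le_rfl⟩ h0
    have := hz us
    rw [h] at this
    linarith
  · rw [hroot z h hF]

lemma wt_eq (β t b lam z : ℝ) :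
    wt β t b lam z = 4 * (exp (-kf t lam) * cosh (lam + t)) * vf β (b + kf t lam) z := by
  have := wS_eq t b lam (z + (b + kf t lam))
  rw [add_sub_cancel_right] at this
  rw [wt, this, vf]; ring

lemma pE_eq' (t b lam z : ℝ) (e : Bool) :
    pE t b lam z e = (1 + spin e * qf t lam (z + (b + kf t lam))) / 2 := by
  rw [← pE_eq t b, add_sub_cancel_right]

lemma wt_pos (β t b lam z : ℝ) : 0 < wt β t b lam z := mul_pos (exp_pos _) (wS_pos _ _ _ _)

lemma wt_cont (β t b lam : ℝ) : Continuous (wt β t b lam) := by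
  unfold wt wS wP; fun_prop

lemma wt_exp (β t b lam : ℝ) (hβ : 0 < β) : ∃ A B : ℝ, ∀ z, wt β t b lam z =
    A * exp (-(1 / (2 * β)) * z ^ 2 + z * 1) + B * exp (-(1 / (2 * β)) * z ^ 2 + z * (-1)) := by
  set K := 4 * (exp (-kf t lam) * cosh (lam + t)) with hK
  refine ⟨K * exp (b + kf t lam) / 2, K * exp (-(b + kf t lam)) / 2, fun z => ?_⟩
  rw [wt_eq, ← hK, vf, cosh_eq, show -z ^ 2 / (2 * β) = -(1 / (2 * β)) * z ^ 2 by ring,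
    exp_add z, exp_add _ (z * 1), exp_add _ (z * (-1)), neg_add z, exp_add (-z), mul_one, mul_neg_one]
  ring

lemma wt_int (β t b lam : ℝ) (hβ : 0 < β) : Integrable (wt β t b lam) := by
  obtain ⟨A, B, h⟩ := wt_exp β t b lam hβ
  rw [show wt β t b lam = _ from funext h]
  have hc : 0 < 1 / (2 * β) := by positivity
  exact ((gauss_int _ _ hc).const_mul A).add ((gauss_int _ _ hc).const_mul B)

lemma wt_tendsto (β t b lam : ℝ) (hβ : 0 < β) : Tendsto (wt β t b lam) (cocompact ℝ) (nhds 0) := by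
  obtain ⟨A, B, h⟩ := wt_exp β t b lam hβ
  rw [show wt β t b lam = _ from funext h]
  have hc : 0 < 1 / (2 * β) := by positivity
  simpa using ((gauss_tendsto _ 1 hc).const_mul A).add ((gauss_tendsto _ (-1) hc).const_mul B)

/-- Expectation with respect to the `N`-th power of the weight. -/
def EN (β t b lam : ℝ) (N : ℕ) (g : ℝ → ℝ) : ℝ :=
  (∫ z, wt β t b lam z ^ N * g z) / ∫ z, wt β t b lam z ^ N

lemma EN_lim (β t b lam : ℝ) (hβ : 0 < β) (g : ℝ → ℝ) (hg : Continuous g) (Cb : ℝ)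
    (hb : ∀ z, |g z| ≤ Cb) (c : ℝ)
    (hc : ∀ z, (∀ y, vf β (b + kf t lam) y ≤ vf β (b + kf t lam) z) → g z = c) :
    Tendsto (fun N => EN β t b lam N g) atTop (nhds c) := by
  refine laplace _ g (wt_cont β t b lam) (wt_pos β t b lam) (wt_int β t b lam hβ)
    (wt_tendsto β t b lam hβ) hg Cb hb c fun z hz => hc z fun y => ?_
  have := hz y
  rw [wt_eq, wt_eq] at this
  refine le_of_mul_le_mul_left this ?_
  have := cosh_pos (lam + t)
  positivity

lemma EN_add (β t b lam : ℝ) (hβ : 0 < β) (g₁ g₂ : ℝ → ℝ) (h₁ : Continuous g₁) (h₂ : Continuous g₂)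
    (b₁ : ∀ z, |g₁ z| ≤ 1) (b₂ : ∀ z, |g₂ z| ≤ 1) (n : ℕ) :
    EN β t b lam (n + 1) (fun z => g₁ z + g₂ z) = EN β t b lam (n + 1) g₁ + EN β t b lam (n + 1) g₂ := by
  have hbd : ∃ C, ∀ z, wt β t b lam z ≤ C := by
    obtain ⟨z0, hz0⟩ := (wt_cont β t b lam).exists_forall_ge' 0
      (((wt_tendsto β t b lam hβ).eventually (gt_mem_nhds (wt_pos β t b lam 0))).mono fun y hy => hy.le)
    exact ⟨_, hz0⟩
  obtain ⟨C, hC⟩ := hbd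
  have hpow : Integrable (fun z => wt β t b lam z ^ (n + 1)) := by
    simp only [pow_succ]
    refine (wt_int β t b lam hβ).bdd_mul (c := C ^ n) ((wt_cont β t b lam).pow n).aestronglyMeasurable ?_
    refine Eventually.of_forall fun z => ?_
    rw [Real.norm_eq_abs, abs_of_pos (pow_pos (wt_pos β t b lam z) n)]
    exact pow_le_pow_left₀ (wt_pos β t b lam z).le (hC z) n
  have hi : ∀ g : ℝ → ℝ, Continuous g → (∀ z, |g z| ≤ 1) →
      Integrable (fun z => wt β t b lam z ^ (n + 1) * g z) := fun g hg hb =>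
    hpow.mul_bdd (c := 1) hg.aestronglyMeasurable (Eventually.of_forall fun z => hb z)
  unfold EN
  rw [← add_div, ← integral_add (hi g₁ h₁ b₁) (hi g₂ h₂ b₂)]
  simp only [mul_add]

lemma pE_cont (t b lam : ℝ) (e : Bool) : Continuous fun z => pE t b lam z e := by
  unfold pE
  refine Continuous.div ?_ ?_ fun z => (wS_pos t b lam z).ne'
  · unfold wP; fun_prop
  · unfold wS wP; fun_prop

lemma pE_nonneg (t b lam z : ℝ) (e : Bool) : 0 ≤ pE t b lam z e :=
  div_nonneg (wP_pos _ _ _ _ _).le (wS_pos _ _ _ _).le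

lemma pE_le (t b lam z : ℝ) (e : Bool) : pE t b lam z e ≤ 1 := by
  unfold pE
  rw [div_le_one (wS_pos _ _ _ _), wS]
  have := wP_pos t b lam z true
  have := wP_pos t b lam z false
  cases e <;> linarith

lemma pE_abs (t b lam z : ℝ) (e : Bool) : |pE t b lam z e| ≤ 1 := by
  rw [abs_of_nonneg (pE_nonneg _ _ _ _ _)]; exact pE_le _ _ _ _ _

lemma prod_abs (N₀ : ℕ) (t b lam z : ℝ) (ηbar : Fin N₀ → Bool) :
    |∏ i, pE t b lam z (ηbar i)| ≤ 1 := by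
  rw [Finset.abs_prod]
  exact Finset.prod_le_one (fun i _ => abs_nonneg _) fun i _ => pE_abs _ _ _ _ _

lemma cyl_ev (N₀ : ℕ) (β ε h₀ lam : ℝ) (hβ : 0 < β) (ηbar : Fin N₀ → Bool) :
    ∀ᶠ N in atTop, etaCylProb N₀ N β ε h₀ lam ηbar =
      EN β (β * ε) (β * h₀) lam N (fun z => ∏ i, pE (β * ε) (β * h₀) lam z (ηbar i)) := by
  filter_upwards [eventually_ge_atTop (N₀ + 1)] with N hN
  obtain ⟨M, rfl⟩ := Nat.exists_eq_add_of_le (show N₀ ≤ N by omega)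
  exact rep N₀ M (by omega) β ε h₀ lam hβ ηbar

lemma pos_lim (β ε h₀ lam us u0 : ℝ) (hβ : 0 < β) 
    (hus : Ft β us = 0)
    (hneg : ∀ u, 0 < u → u < us → Ft β u < 0) (hmono : StrictMonoOn (Ft β) (Set.Ici us))
    (hH : 0 < β * h₀ + kf (β * ε) lam) (hu0 : us < u0)
    (hF : Ft β u0 = β * h₀ + kf (β * ε) lam) (N₀ : ℕ) (ηbar : Fin N₀ → Bool) :
    Tendsto (fun N => etaCylProb N₀ N β ε h₀ lam ηbar) atTop
      (nhds (∏ i, (1 + spin (ηbar i) * qf (β * ε) lam u0) / 2)) := by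
  refine Tendsto.congr' ((cyl_ev N₀ β ε h₀ lam hβ ηbar).mono fun N h => h.symm) ?_
  refine EN_lim _ _ _ _ hβ _ (continuous_finsetProd _ fun i _ => pE_cont _ _ _ _) 1
    (fun z => prod_abs _ _ _ _ _ _) _ fun z hz => ?_
  obtain ⟨h1, h2⟩ := vf_max_pos β _ z hβ hH hz
  have h3 : us < z + (β * h₀ + kf (β * ε) lam) := by
    by_contra hcon
    push Not at hcon
    rcases hcon.lt_or_eq with h | h
    · linarith [hneg _ h1 h]
    · rw [h] at h2; linarith
  have h4 : z + (β * h₀ + kf (β * ε) lam) = u0 :=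
    hmono.injOn h3.le hu0.le (h2.trans hF.symm)
  refine Finset.prod_congr rfl fun i _ => ?_
  rw [pE_eq', h4]

lemma fwd (β ε h₀ lam us : ℝ) (hβ : 1 < β) (hε : 0 < ε) (hus0 : 0 < us) (hus : Ft β us = 0)
    (hneg : ∀ u, 0 < u → u < us → Ft β u < 0) (hmono : StrictMonoOn (Ft β) (Set.Ici us))
    (hH : 0 < β * h₀ + kf (β * ε) lam) (hn : IsNeutral β ε h₀ lam) :
    Gt β (β * ε) us < β * h₀ := by
  have hβ0 : 0 < β := by linarith
  have ht : 0 < β * ε := by positivity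
  set H := β * h₀ + kf (β * ε) lam with hHd
  have hbig : H ≤ Ft β (us + H + β) := by
    unfold Ft; nlinarith [tanh_lt_one (us + H + β)]
  obtain ⟨u0, hu0, hF⟩ := intermediate_value_Icc (by linarith : us ≤ us + H + β)
    (Ft_cont β).continuousOn ⟨by rw [hus]; exact hH.le, hbig⟩
  have hlt : us < u0 := lt_of_le_of_ne hu0.1 fun h => by rw [← h] at hF; linarith
  have hl := pos_lim β ε h₀ lam us u0 hβ0 hus hneg hmono hH hlt hF 1 (fun _ => true)
  have := tendsto_nhds_unique hl (hn 1 (fun _ => true))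
  have h1 : spin true = 1 := by simp [spin]
  simp only [Finset.univ_unique, Finset.prod_singleton, h1, pow_one] at this
  have hq : qf (β * ε) lam u0 = 0 := by linarith
  have hlam := (qf_zero_iff _ _ _ ht).1 hq
  have hk : kf (β * ε) lam = - kf (β * ε) (lamf (β * ε) u0) := by rw [hlam, kf_neg]
  have m1 := hmono Set.self_mem_Ici hlt.le hlt
  have m2 := kf_smono _ ht (lamf_smono _ ht hlt)
  unfold Gt
  linarith

lemma bwd (β ε h₀ us : ℝ) (hβ : 1 < β) (hε : 0 < ε) (hus0 : 0 < us) (hus : Ft β us = 0)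
    (hneg : ∀ u, 0 < u → u < us → Ft β u < 0) (hmono : StrictMonoOn (Ft β) (Set.Ici us))
    (hh : Gt β (β * ε) us < β * h₀) : ∃ lam, IsNeutral β ε h₀ lam := by
  have hβ0 : 0 < β := by linarith
  have ht : 0 < β * ε := by positivity
  have hGpos : 0 < Gt β (β * ε) us := by
    unfold Gt; rw [hus, zero_add]; exact kl_pos _ _ ht hus0
  have hbig : β * h₀ ≤ Gt β (β * ε) (us + β * h₀ + β) := by
    have := kl_pos (β * ε) (us + β * h₀ + β) ht (by linarith)
    unfold Gt Ft; nlinarith [tanh_lt_one (us + β * h₀ + β)]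
  obtain ⟨u0, hu0, hG⟩ := intermediate_value_Icc (by linarith : us ≤ us + β * h₀ + β)
    (Gt_cont β (β * ε)).continuousOn ⟨hh.le, hbig⟩
  have hlt : us < u0 := lt_of_le_of_ne hu0.1 fun h => by rw [← h] at hG; linarith
  have m1 := hmono Set.self_mem_Ici hlt.le hlt
  refine ⟨- lamf (β * ε) u0, fun N₀ ηbar => ?_⟩
  have hF : Ft β u0 = β * h₀ + kf (β * ε) (- lamf (β * ε) u0) := by
    rw [kf_neg]; unfold Gt at hG; linarith
  have hl := pos_lim β ε h₀ (- lamf (β * ε) u0) us u0 hβ0 hus hneg hmono (by linarith) hlt hF N₀ ηbar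
  have hq := (qf_zero_iff (β * ε) (- lamf (β * ε) u0) u0 ht).2 rfl
  simpa [hq] using hl

lemma zero_case (β ε h₀ lam us : ℝ) (hβ : 1 < β) (hε : 0 < ε) (hus0 : 0 < us) (hus : Ft β us = 0)
    (hneg : ∀ u, 0 < u → u < us → Ft β u < 0) (hmono : StrictMonoOn (Ft β) (Set.Ici us))
    (hH : β * h₀ + kf (β * ε) lam = 0) (hn : IsNeutral β ε h₀ lam) : False := by
  have hβ0 : 0 < β := by linarith
  have ht : 0 < β * ε := by positivity
  set t := β * ε with htd
  set b := β * h₀ with hbd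
  have h1 : spin true = 1 := by simp [spin]
  have h2 : spin false = -1 := by simp [spin]
  set A := (tanh (lam + t) + tanh (lam - t)) / 2 with hA
  set B := (tanh (lam + t) - tanh (lam - t)) / 2 with hB
  have hBpos : 0 < B := by
    have := tanh_smono (by linarith : lam - t < lam + t)
    rw [hB]; linarith
  have hp : ∀ z e, pE t b lam z e = (1 + spin e * (A + B * tanh z)) / 2 := by
    intro z e; rw [pE_eq', hH, add_zero]; rfl
  have heven : ∀ z, wt β t b lam (-z) = wt β t b lam z := by
    intro z
    rw [wt_eq, wt_eq, hH, vf, vf, add_zero, add_zero, cosh_neg, neg_sq]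
  -- first moment
  have l1 : Tendsto (fun N => EN β t b lam N (fun z => pE t b lam z true)) atTop (nhds (2⁻¹)) := by
    have := (hn 1 (fun _ => true)).congr' (cyl_ev 1 β ε h₀ lam hβ0 _)
    simpa using this
  have lrefl : ∀ N, EN β t b lam N (fun z => pE t b lam (-z) true)
      = EN β t b lam N (fun z => pE t b lam z true) := by
    intro N
    unfold EN
    congr 1
    rw [← integral_neg_eq_self]
    simp [heven]
  have l2 : Tendsto (fun N => EN β t b lam N (fun z => pE t b lam z true + pE t b lam (-z) true))
      atTop (nhds (2⁻¹ + 2⁻¹)) := by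
    refine (l1.add l1).congr' ?_
    filter_upwards [eventually_ge_atTop 1] with N hN
    obtain ⟨n, rfl⟩ := Nat.exists_eq_add_of_le' hN
    rw [EN_add β t b lam hβ0 (fun z => pE t b lam z true) (fun z => pE t b lam (-z) true)
      (pE_cont _ _ _ _) ((pE_cont _ _ _ _).comp continuous_neg)
      (fun z => pE_abs _ _ _ _ _) (fun z => pE_abs _ _ _ _ _), lrefl]
  have c2 : (fun z => pE t b lam z true + pE t b lam (-z) true) = fun _ => 1 + A := by
    funext z; rw [hp, hp, tanh_neg, h1]; ring
  rw [c2] at l2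
  have l2' := EN_lim β t b lam hβ0 (fun _ => 1 + A) continuous_const |1 + A| (fun _ => le_rfl) (1 + A)
    (fun _ _ => rfl)
  have hA0 : A = 0 := by
    have := tendsto_nhds_unique l2 l2'
    linarith
  -- second moment
  have l3 : ∀ e, Tendsto (fun N => EN β t b lam N (fun z => pE t b lam z e ^ 2)) atTop
      (nhds ((2:ℝ)⁻¹ ^ 2)) := by
    intro e
    have := (hn 2 (fun _ => e)).congr' (cyl_ev 2 β ε h₀ lam hβ0 _)
    simpa using this
  have hsq : ∀ z e, |pE t b lam z e ^ 2| ≤ 1 := by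
    intro z e; rw [abs_pow]; exact pow_le_one₀ (abs_nonneg _) (pE_abs _ _ _ _ _)
  have l4 : Tendsto (fun N => EN β t b lam N (fun z => pE t b lam z true ^ 2 + pE t b lam z false ^ 2))
      atTop (nhds ((2:ℝ)⁻¹ ^ 2 + (2:ℝ)⁻¹ ^ 2)) := by
    refine ((l3 true).add (l3 false)).congr' ?_
    filter_upwards [eventually_ge_atTop 1] with N hN
    obtain ⟨n, rfl⟩ := Nat.exists_eq_add_of_le' hN
    rw [EN_add β t b lam hβ0 (fun z => pE t b lam z true ^ 2) (fun z => pE t b lam z false ^ 2)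
      ((pE_cont _ _ _ _).pow 2) ((pE_cont _ _ _ _).pow 2)
      (fun z => hsq _ _) (fun z => hsq _ _)]
  have l5 := EN_lim β t b lam hβ0 (fun z => pE t b lam z true ^ 2 + pE t b lam z false ^ 2)
    (((pE_cont _ _ _ _).pow 2).add ((pE_cont _ _ _ _).pow 2)) 2
    (fun z => (abs_add_le _ _).trans (by linarith [hsq z true, hsq z false]))
    ((1 + B ^ 2 * tanh us ^ 2) / 2) (fun z hz => by
      rw [hH] at hz
      rw [← vf_max_zero β us z hβ hus0 hus hneg hmono hz, hp, hp, h1, h2, hA0]; ring)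
  have := tendsto_nhds_unique l4 l5
  have hpos : 0 < B ^ 2 * tanh us ^ 2 := by
    have := tanh_pos' hus0; positivity
  linarith

lemma neg_sym (β ε h₀ lam : ℝ) (hn : IsNeutral β ε h₀ lam) : IsNeutral β ε (-h₀) (-lam) := by
  have hs : ∀ e, spin (!e) = - spin e := by intro e; cases e <;> simp [spin]
  have hH : ∀ N (σ η : Fin N → Bool), morH N β ε (-h₀) (-lam) (fun i => !σ i) (fun i => !η i)
      = morH N β ε h₀ lam σ η := by
    intro N σ η
    simp only [morH, hs, Finset.sum_neg_distrib]
    have : ∑ i, (ε * -spin (η i) + -h₀) * -spin (σ i) = ∑ i, (ε * spin (η i) + h₀) * spin (σ i) :=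
      Finset.sum_congr rfl fun i _ => by ring
    rw [this]; ring
  have hre : ∀ N (f : (Fin N → Bool) → ℝ), ∑ σ, f σ = ∑ σ : Fin N → Bool, f (fun i => !σ i) := by
    intro N f
    have hinv : Function.Involutive (fun (σ : Fin N → Bool) i => !σ i) := fun σ => by simp
    exact (Equiv.sum_comp hinv.toPerm f).symm
  have hZ : ∀ N, morZ N β ε (-h₀) (-lam) = morZ N β ε h₀ lam := by
    intro N
    unfold morZ
    rw [hre]
    refine Finset.sum_congr rfl fun σ _ => ?_
    rw [hre]
    simp only [hH]
  intro N₀ ηbar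
  refine (hn N₀ (fun i => !ηbar i)).congr fun N => ?_
  unfold etaCylProb
  rw [hre N (fun σ => ∑ η : Fin N → Bool, if ∀ (i : Fin N₀) (h : (i : ℕ) < N), η ⟨i, h⟩ = ηbar i
    then morK N β ε (-h₀) (-lam) σ η else 0)]
  refine Finset.sum_congr rfl fun σ _ => ?_
  rw [hre N (fun η => if ∀ (i : Fin N₀) (h : (i : ℕ) < N), η ⟨i, h⟩ = ηbar i
    then morK N β ε (-h₀) (-lam) (fun i => !σ i) η else 0)]
  refine Finset.sum_congr rfl fun η _ => ?_
  have : (∀ (i : Fin N₀) (h : (i : ℕ) < N), η ⟨i, h⟩ = !ηbar i) ↔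
      (∀ (i : Fin N₀) (h : (i : ℕ) < N), (!η ⟨i, h⟩) = ηbar i) := by
    refine forall_congr' fun i => forall_congr' fun h => ?_
    cases η ⟨i, h⟩ <;> cases ηbar i <;> simp
  simp only [this, morK, hH, hZ]

/-- For `β > 1`, `ε > 0`, the set of external fields `h₀` admitting a
compensating Morita chemical potential `lam` is exactly `ℝ \ [-a, a]` for some `a > 0`. -/
theorem stmt0 (β ε : ℝ) (hβ : 1 < β) (hε : 0 < ε) :
    ∃ a : ℝ, 0 < a ∧
      {h₀ : ℝ | ∃ lam : ℝ, IsNeutral β ε h₀ lam} = (Set.Icc (-a) a)ᶜ := by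
  obtain ⟨us, hus0, hus, hneg, hmono⟩ := Ft_root β hβ
  have hβ0 : 0 < β := by linarith
  have ht : 0 < β * ε := by positivity
  have hGpos : 0 < Gt β (β * ε) us := by
    unfold Gt; rw [hus, zero_add]; exact kl_pos _ _ ht hus0
  refine ⟨Gt β (β * ε) us / β, by positivity, ?_⟩
  ext h₀
  simp only [Set.mem_ofPred_eq, Set.mem_compl_iff, Set.mem_Icc, not_and_or, not_le]
  constructor
  · rintro ⟨lam, hn⟩
    rcases lt_trichotomy (β * h₀ + kf (β * ε) lam) 0 with h | h | h
    · left
      have := fwd β ε (-h₀) (-lam) us hβ hε hus0 hus hneg hmono (by rw [kf_neg]; linarith)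
        (neg_sym _ _ _ _ hn)
      rw [lt_neg, div_lt_iff₀ hβ0]; linarith
    · exact (zero_case β ε h₀ lam us hβ hε hus0 hus hneg hmono h hn).elim
    · right
      have := fwd β ε h₀ lam us hβ hε hus0 hus hneg hmono h hn
      rw [div_lt_iff₀ hβ0]; linarith
  · rintro (h | h)
    · rw [lt_neg, div_lt_iff₀ hβ0] at h
      obtain ⟨lam, hn⟩ := bwd β ε (-h₀) us hβ hε hus0 hus hneg hmono (by linarith)
      have := neg_sym _ _ _ _ hn
      rw [neg_neg] at this
      exact ⟨_, this⟩
    · rw [div_lt_iff₀ hβ0] at h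
      exact bwd β ε h₀ us hβ hε hus0 hus hneg hmono (by linarith)
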